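/- arXiv:1502.02158 — 3 statements merged into one kernel-verified Lean document; each statement's English description precedes it below -/
import Mathlib

section
/- Let A ∈ ℝ^{n×n} be column-stochastic with a stationary distribution π ∈ ℝ^n (Aπ = π, π entrywise positive, entries summing to 1), and set β = π_{n-1}/(π_{n-1}+π_n). Define M^{(t)} = B A^t C_β ∈ ℝ^{(n-1)×(n-1)}. Then M^{(3)} − M^{(2)} M^{(1)} − M^{(1)} M^{(2)} + (M^{(1)})³ = κ · δout (δin)^T. -/
open Matrix

noncomputable section

/-- Projection ("merge") matrix `B ∈ ℝ^{(n-1)×n}` for `n = m+3` states, merging the two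
last (aliased) states. -/
def Bmat (m : ℕ) : Matrix (Fin (m+2)) (Fin (m+3)) ℝ :=
  Matrix.of fun i j =>
    if ((i : ℕ) = (j : ℕ) ∧ (i : ℕ) ≤ m) ∨ ((i : ℕ) = m + 1 ∧ ((j : ℕ) = m + 1 ∨ (j : ℕ) = m + 2))
    then 1 else 0

/-- Lifting matrix `C_β ∈ ℝ^{n×(n-1)}`. -/
def Cmat (m : ℕ) (β : ℝ) : Matrix (Fin (m+3)) (Fin (m+2)) ℝ :=
  Matrix.of fun i j =>
    if (i : ℕ) = (j : ℕ) ∧ (i : ℕ) ≤ m then 1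
    else if (i : ℕ) = m + 1 ∧ (j : ℕ) = m + 1 then β
    else if (i : ℕ) = m + 2 ∧ (j : ℕ) = m + 1 then 1 - β
    else 0

/-- The first aliased state (state `n-1` in 1-based indexing). -/
def a1 (m : ℕ) : Fin (m+3) := ⟨m+1, by omega⟩
/-- The second aliased state (state `n` in 1-based indexing). -/
def a2 (m : ℕ) : Fin (m+3) := ⟨m+2, by omega⟩
/-- The merged pseudo-state (state `n-1` of the merged chain, 1-based). -/
def aM (m : ℕ) : Fin (m+2) := ⟨m+1, by omega⟩

/-- The vector `b = e_{n-1} - e_n`. -/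
def bvec (m : ℕ) : Fin (m+3) → ℝ := fun i =>
  if (i : ℕ) = m + 1 then 1 else if (i : ℕ) = m + 2 then -1 else 0

/-- The vector `c_β = (1-β) e_{n-1} - β e_n`. -/
def cvec (m : ℕ) (β : ℝ) : Fin (m+3) → ℝ := fun i =>
  if (i : ℕ) = m + 1 then 1 - β else if (i : ℕ) = m + 2 then -β else 0

/-- `P₁ = A_{n-1,n-1} + A_{n,n-1}`. -/
def P1 (m : ℕ) (A : Matrix (Fin (m+3)) (Fin (m+3)) ℝ) : ℝ := A (a1 m) (a1 m) + A (a2 m) (a1 m)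
/-- `P₂ = A_{n-1,n} + A_{n,n}`. -/
def P2 (m : ℕ) (A : Matrix (Fin (m+3)) (Fin (m+3)) ℝ) : ℝ := A (a1 m) (a2 m) + A (a2 m) (a2 m)

/-- The vector `δout ∈ ℝ^{n-1}`. -/
def dOut (m : ℕ) (A : Matrix (Fin (m+3)) (Fin (m+3)) ℝ) : Fin (m+2) → ℝ := fun i =>
  if (i : ℕ) ≤ m then A i.castSucc (a1 m) - A i.castSucc (a2 m) else P1 m A - P2 m A

/-- The vector `δin ∈ ℝ^{n-1}`. -/
def dIn (m : ℕ) (A : Matrix (Fin (m+3)) (Fin (m+3)) ℝ) (β : ℝ) : Fin (m+2) → ℝ := fun j =>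
  if (j : ℕ) ≤ m then A (a1 m) j.castSucc - β * (A (a1 m) j.castSucc + A (a2 m) j.castSucc)
  else β * (A (a1 m) (a1 m) - β * P1 m A) + (1 - β) * (A (a1 m) (a2 m) - β * P2 m A)

/-- The scalar `κ`. -/
def kap (m : ℕ) (A : Matrix (Fin (m+3)) (Fin (m+3)) ℝ) (β : ℝ) : ℝ :=
  (A (a1 m) (a1 m) - β * P1 m A) - (A (a1 m) (a2 m) - β * P2 m A)

/-- A square matrix is column-stochastic: nonnegative entries, every column sums to `1`. -/
def ColStoch {k : ℕ} (M : Matrix (Fin k) (Fin k) ℝ) : Prop :=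
  (∀ i j, 0 ≤ M i j) ∧ ∀ j, ∑ i, M i j = 1

set_option linter.unusedSimpArgs false
lemma h_a1 (m : ℕ) : a1 m = (Fin.last (m+1)).castSucc := rfl
lemma h_a2 (m : ℕ) : a2 m = Fin.last (m+2) := rfl

lemma h_B1 (m : ℕ) (i k : Fin (m+1)) : Bmat m i.castSucc k.castSucc.castSucc = if i = k then 1 else 0 := by
  have := i.isLt
  have := k.isLt
  simp only [Bmat, Matrix.of_apply, Fin.val_castSucc, Fin.ext_iff]
  congr 1
  apply propext
  omega
lemma h_B2 (m : ℕ) (i : Fin (m+1)) : Bmat m i.castSucc (Fin.last (m+1)).castSucc = 0 := by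
  have := i.isLt
  simp only [Bmat, Matrix.of_apply, Fin.val_castSucc, Fin.val_last]
  rw [if_neg]; omega
lemma h_B3 (m : ℕ) (i : Fin (m+1)) : Bmat m i.castSucc (Fin.last (m+2)) = 0 := by
  have := i.isLt
  simp only [Bmat, Matrix.of_apply, Fin.val_castSucc, Fin.val_last]
  rw [if_neg]; omega
lemma h_B4 (m : ℕ) (k : Fin (m+1)) : Bmat m (Fin.last (m+1)) k.castSucc.castSucc = 0 := by
  have := k.isLt
  simp only [Bmat, Matrix.of_apply, Fin.val_castSucc, Fin.val_last]
  rw [if_neg]; omega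
lemma h_B5 (m : ℕ) : Bmat m (Fin.last (m+1)) (Fin.last (m+1)).castSucc = 1 := by
  simp [Bmat]
lemma h_B6 (m : ℕ) : Bmat m (Fin.last (m+1)) (Fin.last (m+2)) = 1 := by
  simp [Bmat]

lemma h_C1 (m : ℕ) (β : ℝ) (i k : Fin (m+1)) :
    Cmat m β k.castSucc.castSucc i.castSucc = if k = i then 1 else 0 := by
  have := i.isLt
  have := k.isLt
  simp only [Cmat, Matrix.of_apply, Fin.val_castSucc, Fin.ext_iff]
  split_ifs <;> first | rfl | omega
lemma h_C2 (m : ℕ) (β : ℝ) (i : Fin (m+1)) : Cmat m β (Fin.last (m+1)).castSucc i.castSucc = 0 := by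
  have := i.isLt
  simp only [Cmat, Matrix.of_apply, Fin.val_castSucc, Fin.val_last]
  split_ifs <;> first | rfl | omega
lemma h_C3 (m : ℕ) (β : ℝ) (i : Fin (m+1)) : Cmat m β (Fin.last (m+2)) i.castSucc = 0 := by
  have := i.isLt
  simp only [Cmat, Matrix.of_apply, Fin.val_castSucc, Fin.val_last]
  split_ifs <;> first | rfl | omega
lemma h_C4 (m : ℕ) (β : ℝ) (k : Fin (m+1)) : Cmat m β k.castSucc.castSucc (Fin.last (m+1)) = 0 := by
  have := k.isLt
  simp only [Cmat, Matrix.of_apply, Fin.val_castSucc, Fin.val_last]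
  split_ifs <;> first | rfl | omega
lemma h_C5 (m : ℕ) (β : ℝ) : Cmat m β (Fin.last (m+1)).castSucc (Fin.last (m+1)) = β := by
  simp [Cmat]
lemma h_C6 (m : ℕ) (β : ℝ) : Cmat m β (Fin.last (m+2)) (Fin.last (m+1)) = 1 - β := by
  simp [Cmat]

lemma h_b1 (m : ℕ) (k : Fin (m+1)) : bvec m k.castSucc.castSucc = 0 := by
  have := k.isLt
  simp only [bvec, Fin.val_castSucc]
  split_ifs <;> first | rfl | omega
lemma h_b2 (m : ℕ) : bvec m (Fin.last (m+1)).castSucc = 1 := by simp [bvec]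
lemma h_b3 (m : ℕ) : bvec m (Fin.last (m+2)) = -1 := by simp [bvec]
lemma h_c1 (m : ℕ) (β : ℝ) (k : Fin (m+1)) : cvec m β k.castSucc.castSucc = 0 := by
  have := k.isLt
  simp only [cvec, Fin.val_castSucc]
  split_ifs <;> first | rfl | omega
lemma h_c2 (m : ℕ) (β : ℝ) : cvec m β (Fin.last (m+1)).castSucc = 1 - β := by simp [cvec]
lemma h_c3 (m : ℕ) (β : ℝ) : cvec m β (Fin.last (m+2)) = -β := by simp [cvec]

lemma h_CB (m : ℕ) (β : ℝ) : Cmat m β * Bmat m = 1 - vecMulVec (bvec m) (cvec m β) := by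
  ext i j
  rw [Matrix.mul_apply, Fin.sum_univ_castSucc, Matrix.sub_apply, vecMulVec_apply, Matrix.one_apply]
  induction i using Fin.lastCases with
  | last =>
    induction j using Fin.lastCases with
    | last => simp [h_B1, h_B2, h_B3, h_B4, h_B5, h_B6, h_C1, h_C2, h_C3, h_C4, h_C5, h_C6, h_b1, h_b2, h_b3, h_c1, h_c2, h_c3, (Fin.castSucc_ne_last _).symm]
    | cast j =>
      induction j using Fin.lastCases <;>
        simp [h_B1, h_B2, h_B3, h_B4, h_B5, h_B6, h_C1, h_C2, h_C3, h_C4, h_C5, h_C6, h_b1, h_b2, h_b3, h_c1, h_c2, h_c3, Fin.ext_iff] <;> omega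
  | cast i =>
    induction i using Fin.lastCases <;>
    induction j using Fin.lastCases with
    | last => simp [h_B1, h_B2, h_B3, h_B4, h_B5, h_B6, h_C1, h_C2, h_C3, h_C4, h_C5, h_C6, h_b1, h_b2, h_b3, h_c1, h_c2, h_c3, (Fin.castSucc_ne_last _).symm]
    | cast j =>
      induction j using Fin.lastCases <;>
        simp [h_B1, h_B2, h_B3, h_B4, h_B5, h_B6, h_C1, h_C2, h_C3, h_C4, h_C5, h_C6, h_b1, h_b2, h_b3, h_c1, h_c2, h_c3, (Fin.castSucc_ne_last _).symm]

lemma h_Ab (m : ℕ) (A : Matrix (Fin (m+3)) (Fin (m+3)) ℝ) (i : Fin (m+3)) :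
    (A *ᵥ bvec m) i = A i (a1 m) - A i (a2 m) := by
  rw [h_a1, h_a2, Matrix.mulVec, dotProduct, Fin.sum_univ_castSucc, Fin.sum_univ_castSucc]
  simp [h_b1, h_b2, h_b3]
  ring

lemma h_cA (m : ℕ) (β : ℝ) (A : Matrix (Fin (m+3)) (Fin (m+3)) ℝ) (j : Fin (m+3)) :
    (cvec m β ᵥ* A) j = A (a1 m) j - β * (A (a1 m) j + A (a2 m) j) := by
  rw [h_a1, h_a2, Matrix.vecMul, dotProduct, Fin.sum_univ_castSucc, Fin.sum_univ_castSucc]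
  simp [h_c1, h_c2, h_c3, (Fin.castSucc_ne_last _).symm]
  ring

lemma h_out (m : ℕ) (A : Matrix (Fin (m+3)) (Fin (m+3)) ℝ) :
    Bmat m *ᵥ (A *ᵥ bvec m) = dOut m A := by
  ext i
  rw [Matrix.mulVec, dotProduct, Fin.sum_univ_castSucc, Fin.sum_univ_castSucc]
  simp only [h_Ab]
  induction i using Fin.lastCases with
  | last => 
    simp [h_B4, h_B5, h_B6, dOut, P1, P2, h_a1, h_a2]
    ring
  | cast i =>
    have := i.isLt
    simp [h_B1, h_B2, h_B3, dOut, Nat.lt_succ_iff.mp this]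

lemma h_in (m : ℕ) (β : ℝ) (A : Matrix (Fin (m+3)) (Fin (m+3)) ℝ) :
    (cvec m β ᵥ* A) ᵥ* Cmat m β = dIn m A β := by
  ext i
  rw [Matrix.vecMul, dotProduct, Fin.sum_univ_castSucc, Fin.sum_univ_castSucc]
  simp only [h_cA]
  induction i using Fin.lastCases with
  | last => 
    simp [h_C4, h_C5, h_C6, dIn, P1, P2, h_a1, h_a2]
    ring
  | cast i =>
    have := i.isLt
    simp [h_C1, h_C2, h_C3, dIn, Nat.lt_succ_iff.mp this]

lemma h_kap (m : ℕ) (β : ℝ) (A : Matrix (Fin (m+3)) (Fin (m+3)) ℝ) :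
    cvec m β ⬝ᵥ (A *ᵥ bvec m) = kap m A β := by
  rw [dotProduct, Fin.sum_univ_castSucc, Fin.sum_univ_castSucc]
  simp [h_Ab, h_c1, h_c2, h_c3, kap, P1, P2, h_a1, h_a2]
  ring

theorem stmt3 (m : ℕ) (A : Matrix (Fin (m+3)) (Fin (m+3)) ℝ) (hA : ColStoch A)
    (π : Fin (m+3) → ℝ) (hstat : A.mulVec π = π) (hpos : ∀ i, 0 < π i)
    (hsum : ∑ i, π i = 1)
    (β : ℝ) (hβ : β = π (a1 m) / (π (a1 m) + π (a2 m)))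
    (M : ℕ → Matrix (Fin (m+2)) (Fin (m+2)) ℝ)
    (hM : ∀ t, M t = Bmat m * A ^ t * Cmat m β) :
    M 3 - M 2 * M 1 - M 1 * M 2 + (M 1) ^ 3
      = kap m A β • vecMulVec (dOut m A) (dIn m A β) := by
  have key : M 3 - M 2 * M 1 - M 1 * M 2 + (M 1) ^ 3
      = Bmat m * A * (1 - Cmat m β * Bmat m) * A * (1 - Cmat m β * Bmat m) * A * Cmat m β := by
    simp only [hM, pow_succ, pow_zero, Matrix.one_mul, Matrix.mul_sub, Matrix.sub_mul,
      Matrix.mul_one, Matrix.mul_assoc]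
    abel
  rw [key, h_CB, sub_sub_cancel, ← h_out, ← h_in, ← h_kap]
  simp only [Matrix.mul_assoc, Matrix.vecMulVec_mul, Matrix.mul_vecMulVec,
    Matrix.vecMulVec_mul_vecMulVec, Matrix.mulVec_mulVec, Matrix.vecMul_vecMul]
  ext i j
  simp [vecMulVec_apply, Matrix.dotProduct_mulVec, Matrix.vecMulVec_mulVec]
  try ring
end
end

section
/- Let A ∈ ℝ^{n×n} be column-stochastic with P₁ ≥ P₂ and A_{n-1,n-1} P₂ ≥ A_{n-1,n} P₁ (the case α_{n-1} ≥ α_n of relative entrance probabilities into the aliased states). Let τ₁ > τ₂ and A_H = S(τ₁,τ₂)^{-1} A S(τ₁,τ₂). If the two off-diagonal aliased-block entries are nonnegative, i.e. (A_H)_{n,n-1} ≥ 0 and (A_H)_{n-1,n} ≥ 0, then the two diagonal aliased-block entries are also nonnegative: (A_H)_{n-1,n-1} ≥ 0 and (A_H)_{n,n} ≥ 0. Consequently, in this case the feasible region Γ_H = {(τ₁,τ₂) : τ₁ > τ₂, A_H(τ₁,τ₂) entrywise ≥ 0} equals the set of (τ₁,τ₂) with τ₁ > τ₂ at which all entries of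 A_H outside the bottom-right 2×2 block and the two off-diagonal block entries are nonnegative. -/
open Matrix

noncomputable section

/-- The similarity transformation matrix `S(τ₁,τ₂)`: identity except in the bottom-right
`2×2` block, where it equals `[[τ₁, τ₂],[1-τ₁, 1-τ₂]]`. -/
def Smat (m : ℕ) (τ1 τ2 : ℝ) : Matrix (Fin (m+3)) (Fin (m+3)) ℝ :=
  Matrix.of fun i j =>
    if (i : ℕ) = m + 1 ∧ (j : ℕ) = m + 1 then τ1
    else if (i : ℕ) = m + 2 ∧ (j : ℕ) = m + 1 then 1 - τ1
    else if (i : ℕ) = m + 1 ∧ (j : ℕ) = m + 2 then τ2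
    else if (i : ℕ) = m + 2 ∧ (j : ℕ) = m + 2 then 1 - τ2
    else if i = j then 1 else 0

/-- The similarity-transformed transition matrix `A_H(τ₁,τ₂) = S(τ₁,τ₂)⁻¹ A S(τ₁,τ₂)`. -/
def AHmat (m : ℕ) (A : Matrix (Fin (m+3)) (Fin (m+3)) ℝ) (τ1 τ2 : ℝ) :
    Matrix (Fin (m+3)) (Fin (m+3)) ℝ :=
  (Smat m τ1 τ2)⁻¹ * A * Smat m τ1 τ2

theorem Smul_a1 (m : ℕ) (t1 t2 : ℝ) (X : Matrix (Fin (m+3)) (Fin (m+3)) ℝ) (j : Fin (m+3)) :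
    (Smat m t1 t2 * X) (a1 m) j = t1 * X (a1 m) j + t2 * X (a2 m) j := by
  have hne : a1 m ≠ a2 m := by simp [a1, a2]
  rw [Matrix.mul_apply, Fintype.sum_eq_add (a1 m) (a2 m) hne]
  · simp [Smat, a1, a2]
  · rintro x ⟨h1, h2⟩
    have h1' : (x : ℕ) ≠ m + 1 := fun h => h1 (Fin.ext h)
    have h2' : (x : ℕ) ≠ m + 2 := fun h => h2 (Fin.ext h)
    have h3 : a1 m ≠ x := fun h => h1 h.symm
    simp [Smat, h1', h2', h3]

theorem Smul_a2 (m : ℕ) (t1 t2 : ℝ) (X : Matrix (Fin (m+3)) (Fin (m+3)) ℝ) (j : Fin (m+3)) :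
    (Smat m t1 t2 * X) (a2 m) j = (1 - t1) * X (a1 m) j + (1 - t2) * X (a2 m) j := by
  have hne : a1 m ≠ a2 m := by simp [a1, a2]
  rw [Matrix.mul_apply, Fintype.sum_eq_add (a1 m) (a2 m) hne]
  · simp [Smat, a1, a2]
  · rintro x ⟨h1, h2⟩
    have h1' : (x : ℕ) ≠ m + 1 := fun h => h1 (Fin.ext h)
    have h2' : (x : ℕ) ≠ m + 2 := fun h => h2 (Fin.ext h)
    have h3 : a2 m ≠ x := fun h => h2 h.symm
    simp [Smat, h1', h2', h3]

theorem Smul_other (m : ℕ) (t1 t2 : ℝ) (X : Matrix (Fin (m+3)) (Fin (m+3)) ℝ) (i j : Fin (m+3))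
    (h1 : (i : ℕ) ≠ m + 1) (h2 : (i : ℕ) ≠ m + 2) :
    (Smat m t1 t2 * X) i j = X i j := by
  rw [Matrix.mul_apply, Fintype.sum_eq_single i]
  · simp [Smat, h1, h2]
  · intro x hx
    simp [Smat, h1, h2, hx.symm]

theorem mulS_a1 (m : ℕ) (t1 t2 : ℝ) (X : Matrix (Fin (m+3)) (Fin (m+3)) ℝ) (i : Fin (m+3)) :
    (X * Smat m t1 t2) i (a1 m) = t1 * X i (a1 m) + (1 - t1) * X i (a2 m) := by
  have hne : a1 m ≠ a2 m := by simp [a1, a2]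
  rw [Matrix.mul_apply, Fintype.sum_eq_add (a1 m) (a2 m) hne]
  · simp [Smat, a1, a2]; ring
  · rintro x ⟨h1, h2⟩
    have h1' : (x : ℕ) ≠ m + 1 := fun h => h1 (Fin.ext h)
    have h2' : (x : ℕ) ≠ m + 2 := fun h => h2 (Fin.ext h)
    simp [Smat, h1', h2', h1]

theorem mulS_a2 (m : ℕ) (t1 t2 : ℝ) (X : Matrix (Fin (m+3)) (Fin (m+3)) ℝ) (i : Fin (m+3)) :
    (X * Smat m t1 t2) i (a2 m) = t2 * X i (a1 m) + (1 - t2) * X i (a2 m) := by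
  have hne : a1 m ≠ a2 m := by simp [a1, a2]
  rw [Matrix.mul_apply, Fintype.sum_eq_add (a1 m) (a2 m) hne]
  · simp [Smat, a1, a2]; ring
  · rintro x ⟨h1, h2⟩
    have h1' : (x : ℕ) ≠ m + 1 := fun h => h1 (Fin.ext h)
    have h2' : (x : ℕ) ≠ m + 2 := fun h => h2 (Fin.ext h)
    simp [Smat, h1', h2', h2]

theorem Sinv (m : ℕ) (t1 t2 : ℝ) (h : t2 < t1) :
    (Smat m t1 t2)⁻¹ = Smat m ((1 - t2) / (t1 - t2)) (-t2 / (t1 - t2)) := by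
  have hD : t1 - t2 ≠ 0 := by linarith
  apply Matrix.inv_eq_right_inv
  ext i j
  by_cases h1 : i = a1 m
  · subst h1
    rw [Smul_a1]
    by_cases k1 : j = a1 m
    · subst k1; simp [Smat, a1, a2, Matrix.one_apply]; field_simp; ring
    by_cases k2 : j = a2 m
    · subst k2; simp [Smat, a1, a2, Matrix.one_apply]; field_simp; ring
    have h1' : (j : ℕ) ≠ m + 1 := fun h => k1 (Fin.ext h)
    have h2' : (j : ℕ) ≠ m + 2 := fun h => k2 (Fin.ext h)
    simp [Smat, h1', h2', Ne.symm k1, Ne.symm k2]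
  by_cases h2 : i = a2 m
  · subst h2
    rw [Smul_a2]
    by_cases k1 : j = a1 m
    · subst k1; simp [Smat, a1, a2, Matrix.one_apply]; field_simp; ring
    by_cases k2 : j = a2 m
    · subst k2; simp [Smat, a1, a2, Matrix.one_apply]; field_simp; ring
    have h1' : (j : ℕ) ≠ m + 1 := fun h => k1 (Fin.ext h)
    have h2' : (j : ℕ) ≠ m + 2 := fun h => k2 (Fin.ext h)
    simp [Smat, h1', h2', Ne.symm k1, Ne.symm k2]
  have h1' : (i : ℕ) ≠ m + 1 := fun h => h1 (Fin.ext h)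
  have h2' : (i : ℕ) ≠ m + 2 := fun h => h2 (Fin.ext h)
  rw [Smul_other _ _ _ _ _ _ h1' h2']
  simp [Smat, h1', h2', Matrix.one_apply]

theorem key (m : ℕ) (A : Matrix (Fin (m+3)) (Fin (m+3)) ℝ) (hA : ColStoch A)
    (hα : A (a1 m) (a2 m) * P1 m A ≤ A (a1 m) (a1 m) * P2 m A)
    (t1 t2 : ℝ) (h : t2 < t1)
    (h21 : 0 ≤ AHmat m A t1 t2 (a2 m) (a1 m)) (h12 : 0 ≤ AHmat m A t1 t2 (a1 m) (a2 m)) :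
    0 ≤ AHmat m A t1 t2 (a1 m) (a1 m) ∧ 0 ≤ AHmat m A t1 t2 (a2 m) (a2 m) := by
  have hD : t1 - t2 ≠ 0 := by linarith
  have htr : AHmat m A t1 t2 (a1 m) (a1 m) + AHmat m A t1 t2 (a2 m) (a2 m)
      = A (a1 m) (a1 m) + A (a2 m) (a2 m) := by
    simp only [AHmat, Sinv m t1 t2 h, mulS_a1, mulS_a2, Smul_a1, Smul_a2]
    field_simp; ring
  have hdet : AHmat m A t1 t2 (a1 m) (a1 m) * AHmat m A t1 t2 (a2 m) (a2 m)
      - AHmat m A t1 t2 (a1 m) (a2 m) * AHmat m A t1 t2 (a2 m) (a1 m)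
      = A (a1 m) (a1 m) * A (a2 m) (a2 m) - A (a1 m) (a2 m) * A (a2 m) (a1 m) := by
    simp only [AHmat, Sinv m t1 t2 h, mulS_a1, mulS_a2, Smul_a1, Smul_a2]
    field_simp; ring
  have e1 := hA.1 (a1 m) (a1 m)
  have e2 := hA.1 (a2 m) (a2 m)
  have hp := mul_nonneg h12 h21
  simp only [P1, P2] at hα
  generalize AHmat m A t1 t2 (a1 m) (a1 m) = x at *
  generalize AHmat m A t1 t2 (a2 m) (a2 m) = y at *
  have hxy : 0 ≤ x * y := by nlinarith
  constructor
  · by_contra hx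
    nlinarith
  · by_contra hx
    nlinarith

theorem stmt15 (m : ℕ) (A : Matrix (Fin (m+3)) (Fin (m+3)) ℝ) (hA : ColStoch A)
    (hP : P2 m A ≤ P1 m A)
    (hα : A (a1 m) (a2 m) * P1 m A ≤ A (a1 m) (a1 m) * P2 m A) :
    (∀ τ1 τ2 : ℝ, τ2 < τ1 →
      0 ≤ AHmat m A τ1 τ2 (a2 m) (a1 m) → 0 ≤ AHmat m A τ1 τ2 (a1 m) (a2 m) →
      0 ≤ AHmat m A τ1 τ2 (a1 m) (a1 m) ∧ 0 ≤ AHmat m A τ1 τ2 (a2 m) (a2 m))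
    ∧ {p : ℝ × ℝ | p.2 < p.1 ∧ ∀ i j, 0 ≤ AHmat m A p.1 p.2 i j}
      = {p : ℝ × ℝ | p.2 < p.1
          ∧ (∀ i j : Fin (m+3), ((i : ℕ) ≤ m ∨ (j : ℕ) ≤ m) → 0 ≤ AHmat m A p.1 p.2 i j)
          ∧ 0 ≤ AHmat m A p.1 p.2 (a2 m) (a1 m)
          ∧ 0 ≤ AHmat m A p.1 p.2 (a1 m) (a2 m)} := by
  refine ⟨fun t1 t2 h h21 h12 => key m A hA hα t1 t2 h h21 h12, ?_⟩
  ext p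
  simp only [Set.mem_setOf_eq]
  constructor
  · rintro ⟨h, hn⟩
    exact ⟨h, fun i j _ => hn i j, hn _ _, hn _ _⟩
  · rintro ⟨h, hn, h21, h12⟩
    obtain ⟨h11, h22⟩ := key m A hA hα p.1 p.2 h h21 h12
    refine ⟨h, fun i j => ?_⟩
    by_cases hij : (i : ℕ) ≤ m ∨ (j : ℕ) ≤ m
    · exact hn i j hij
    · have hi : i = a1 m ∨ i = a2 m := by
        simp only [a1, a2, Fin.ext_iff]; omega
      have hj : j = a1 m ∨ j = a2 m := by
        simp only [a1, a2, Fin.ext_iff]; omega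
      rcases hi with rfl | rfl <;> rcases hj with rfl | rfl <;> assumption
end
end

section
/- Let A ∈ ℝ^{n×n} be column-stochastic, n ≥ 3, and suppose there exist indices i₁, i₂, j₁, j₂ ∈ {1,…,n-2} such that A_{n-1,i₁} > 0, A_{n,i₁} = 0, A_{n,i₂} > 0, A_{n-1,i₂} = 0, A_{j₁,n-1} > 0, A_{j₁,n} = 0, A_{j₂,n} > 0, and A_{j₂,n-1} = 0. Then for all real τ₁ > τ₂, if every entry of S(τ₁,τ₂)^{-1} A S(τ₁,τ₂) is nonnegative, then (τ₁, τ₂) = (1, 0). (That is, the feasible region Γ_H is the singleton {(1,0)}, so the 2-aliased HMM with transition matrix A is strictly identifiable.) -/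
open Matrix

noncomputable section

theorem sum_split (m : ℕ) (f : Fin (m+3) → ℝ) :
    ∑ k, f k = (∑ k : Fin (m+1), f k.castSucc.castSucc) + f (a1 m) + f (a2 m) := by
  rw [Fin.sum_univ_castSucc, Fin.sum_univ_castSucc]
  rfl

theorem S_row1 (m : ℕ) (t s : ℝ) (M : Matrix (Fin (m+3)) (Fin (m+3)) ℝ) (j : Fin (m+3)) :
    (Smat m t s * M) (a1 m) j = t * M (a1 m) j + s * M (a2 m) j := by
  rw [Matrix.mul_apply, sum_split, Finset.sum_eq_zero]
  · simp [Smat, a1, a2]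
  · intro k _
    have := k.2
    simp [Smat, a1, Fin.ext_iff]
    split_ifs <;> first | rfl | omega

theorem S_row2 (m : ℕ) (t s : ℝ) (M : Matrix (Fin (m+3)) (Fin (m+3)) ℝ) (j : Fin (m+3)) :
    (Smat m t s * M) (a2 m) j = (1 - t) * M (a1 m) j + (1 - s) * M (a2 m) j := by
  rw [Matrix.mul_apply, sum_split, Finset.sum_eq_zero]
  · simp [Smat, a1, a2]
  · intro k _
    have := k.2
    simp [Smat, a2, Fin.ext_iff]
    split_ifs <;> first | rfl | omega

theorem S_row0 (m : ℕ) (t s : ℝ) (M : Matrix (Fin (m+3)) (Fin (m+3)) ℝ) (i j : Fin (m+3))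
    (hi : (i : ℕ) ≤ m) : (Smat m t s * M) i j = M i j := by
  have e1 : (i : ℕ) ≠ m + 1 := by omega
  have e2 : (i : ℕ) ≠ m + 2 := by omega
  rw [Matrix.mul_apply]
  simp [Smat, e1, e2]

theorem S_col1 (m : ℕ) (t s : ℝ) (M : Matrix (Fin (m+3)) (Fin (m+3)) ℝ) (i : Fin (m+3)) :
    (M * Smat m t s) i (a1 m) = M i (a1 m) * t + M i (a2 m) * (1 - t) := by
  rw [Matrix.mul_apply, sum_split, Finset.sum_eq_zero]
  · simp [Smat, a1, a2]
  · intro k _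
    have := k.2
    simp [Smat, a1, Fin.ext_iff]
    split_ifs <;> first | rfl | omega

theorem S_col2 (m : ℕ) (t s : ℝ) (M : Matrix (Fin (m+3)) (Fin (m+3)) ℝ) (i : Fin (m+3)) :
    (M * Smat m t s) i (a2 m) = M i (a1 m) * s + M i (a2 m) * (1 - s) := by
  rw [Matrix.mul_apply, sum_split, Finset.sum_eq_zero]
  · simp [Smat, a1, a2]
  · intro k _
    have := k.2
    simp [Smat, a2, Fin.ext_iff]
    split_ifs <;> first | rfl | omega

theorem S_col0 (m : ℕ) (t s : ℝ) (M : Matrix (Fin (m+3)) (Fin (m+3)) ℝ) (i j : Fin (m+3))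
    (hj : (j : ℕ) ≤ m) : (M * Smat m t s) i j = M i j := by
  have e1 : (j : ℕ) ≠ m + 1 := by omega
  have e2 : (j : ℕ) ≠ m + 2 := by omega
  rw [Matrix.mul_apply]
  simp [Smat, e1, e2]

theorem S_inv (m : ℕ) (t s : ℝ) (h : s < t) :
    Smat m t s * Smat m ((1 - s) / (t - s)) (-s / (t - s)) = 1 := by
  have hd : t - s ≠ 0 := (sub_pos.2 h).ne'
  have cases3 : ∀ i : Fin (m+3), (i : ℕ) ≤ m ∨ i = a1 m ∨ i = a2 m := by
    intro i
    have := i.2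
    simp only [a1, a2, Fin.ext_iff]
    omega
  ext i j
  rcases cases3 i with hi | rfl | rfl
  · rw [S_row0 _ _ _ _ _ _ hi]
    have e1 : (i : ℕ) ≠ m + 1 := by omega
    have e2 : (i : ℕ) ≠ m + 2 := by omega
    simp [Smat, e1, e2, Matrix.one_apply]
  · rw [S_row1]
    rcases cases3 j with hj | rfl | rfl
    · have e1 : (j : ℕ) ≠ m + 1 := by omega
      have e2 : (j : ℕ) ≠ m + 2 := by omega
      simp [Smat, a1, a2, e1, e2, Matrix.one_apply, Fin.ext_iff, e1.symm, e2.symm]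
    · simp [Smat, a1, a2, Matrix.one_apply, Fin.ext_iff]
      field_simp
      ring
    · simp [Smat, a1, a2, Matrix.one_apply, Fin.ext_iff]
      field_simp
      ring
  · rw [S_row2]
    rcases cases3 j with hj | rfl | rfl
    · have e1 : (j : ℕ) ≠ m + 1 := by omega
      have e2 : (j : ℕ) ≠ m + 2 := by omega
      simp [Smat, a1, a2, e1, e2, Matrix.one_apply, Fin.ext_iff, e1.symm, e2.symm]
    · simp [Smat, a1, a2, Matrix.one_apply, Fin.ext_iff]
      field_simp
      ring
    · simp [Smat, a1, a2, Matrix.one_apply, Fin.ext_iff]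
      field_simp
      ring

theorem stmt18 (m : ℕ) (A : Matrix (Fin (m+3)) (Fin (m+3)) ℝ) (hA : ColStoch A)
    (i1 i2 j1 j2 : Fin (m+3))
    (hi1 : (i1 : ℕ) ≤ m) (hi2 : (i2 : ℕ) ≤ m) (hj1 : (j1 : ℕ) ≤ m) (hj2 : (j2 : ℕ) ≤ m)
    (h1 : 0 < A (a1 m) i1) (h2 : A (a2 m) i1 = 0)
    (h3 : 0 < A (a2 m) i2) (h4 : A (a1 m) i2 = 0)
    (h5 : 0 < A j1 (a1 m)) (h6 : A j1 (a2 m) = 0)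
    (h7 : 0 < A j2 (a2 m)) (h8 : A j2 (a1 m) = 0) :
    ∀ τ1 τ2 : ℝ, τ2 < τ1 → (∀ i j, 0 ≤ AHmat m A τ1 τ2 i j) → (τ1, τ2) = (1, 0) := by
  intro t s hts hN
  have hSS : Smat m t s * (Smat m t s)⁻¹ = 1 := by
    rw [Matrix.inv_eq_right_inv (S_inv m t s hts), S_inv m t s hts]
  have key : Smat m t s * AHmat m A t s = A * Smat m t s := by
    rw [AHmat, ← Matrix.mul_assoc, ← Matrix.mul_assoc, hSS, Matrix.one_mul]
  generalize AHmat m A t s = N at hN key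
  have k : ∀ i j, (Smat m t s * N) i j = (A * Smat m t s) i j := fun i j => by rw [key]
  have q1 := k j1 (a2 m)
  rw [S_row0 _ _ _ _ _ _ hj1, S_col2, h6] at q1
  have q2 := k j2 (a1 m)
  rw [S_row0 _ _ _ _ _ _ hj2, S_col1, h8] at q2
  have r1 := k (a1 m) i1
  have r2 := k (a2 m) i1
  have r3 := k (a1 m) i2
  have r4 := k (a2 m) i2
  rw [S_row1, S_col0 _ _ _ _ _ _ hi1] at r1
  rw [S_row2, S_col0 _ _ _ _ _ _ hi1, h2] at r2
  rw [S_row1, S_col0 _ _ _ _ _ _ hi2, h4] at r3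
  rw [S_row2, S_col0 _ _ _ _ _ _ hi2] at r4
  have hs : 0 ≤ s := by
    have := hN j1 (a2 m)
    by_contra hc
    nlinarith
  have ht : t ≤ 1 := by
    have := hN j2 (a1 m)
    by_contra hc
    nlinarith
  have x1 := hN (a1 m) i1
  have y1 := hN (a2 m) i1
  have x2 := hN (a1 m) i2
  have y2 := hN (a2 m) i2
  have hy1 : N (a2 m) i1 = 0 := by
    have e := mul_nonneg (sub_nonneg.2 ht) x1
    have e' : 0 < 1 - s := by linarith
    by_contra hc
    have := mul_pos e' (lt_of_le_of_ne y1 (Ne.symm hc))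
    linarith
  have hx2 : N (a1 m) i2 = 0 := by
    have e := mul_nonneg hs y2
    have e' : 0 < t := by linarith
    by_contra hc
    have := mul_pos e' (lt_of_le_of_ne x2 (Ne.symm hc))
    linarith
  rw [hy1] at r1 r2
  rw [hx2] at r3 r4
  have t1 : t = 1 := by
    have : (1 - t) * N (a1 m) i1 = 0 := by linarith
    rcases mul_eq_zero.1 this with h | h
    · linarith
    · rw [h] at r1; linarith
  have s0 : s = 0 := by
    have : s * N (a2 m) i2 = 0 := by linarith
    rcases mul_eq_zero.1 this with h | h
    · exact h
    · rw [h] at r4; linarith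
  rw [t1, s0]
end
end
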